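/- arXiv:1008.5218 — 3 statements merged into one kernel-verified Lean document; each statement's English description precedes it below -/
import Mathlib

section
/- Let A and E be n×n Hermitian matrices partitioned conformally as A = [[A11, A21^H],[A21, A22]] and E = [[E11, E21^H],[E21, E22]], with A22 of size k×k. Let λ_i and λ̂_i be the i-th smallest eigenvalues of A and A+E respectively, and define τ_i = (‖A21‖₂ + ‖E21‖₂)/(min_j |λ_i − λ_j(A22)| − 2‖E‖₂). If min_j |λ_i − λ_j(A22)| > 2‖E‖₂ (so τ_i > 0), and λ_i(t) is simple for all t ∈ [0,1], then |λ_i − λ̂_i| ≤ ‖E11‖₂ + 2‖E21‖₂ τ_i + ‖E22‖₂ τ_i². -/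
open Matrix

noncomputable def euclNorm {K : Type*} [RCLike K] {I : Type*} [Fintype I] (x : I → K) : ℝ :=
  Real.sqrt (∑ i, ‖x i‖ ^ 2)

noncomputable def specNorm {K : Type*} [RCLike K] {I J : Type*} [Fintype I] [Fintype J]
    [DecidableEq J] (M : Matrix I J K) : ℝ :=
  ‖LinearMap.toContinuousLinearMap (Matrix.toEuclideanLin M)‖

noncomputable def ithEig {K : Type*} [RCLike K] {I : Type*} [Fintype I] [DecidableEq I]
    {A : Matrix I I K} (hA : A.IsHermitian) (i : Fin (Fintype.card I)) : ℝ :=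
  (hA.eigenvalues ∘ (Fintype.equivFin I).symm)
    (Tuple.sort (hA.eigenvalues ∘ (Fintype.equivFin I).symm) i)

open Filter Topology

theorem ithEig_congr {I : Type*} [Fintype I] [DecidableEq I] {A B : Matrix I I ℂ}
    (hA : A.IsHermitian) (hB : B.IsHermitian) (h : A = B) (i : Fin (Fintype.card I)) :
    ithEig hA i = ithEig hB i := by
  subst h; rfl

theorem ithEig_monotone {I : Type*} [Fintype I] [DecidableEq I] {A : Matrix I I ℂ}
    (hA : A.IsHermitian) : Monotone (ithEig hA) :=
  Tuple.monotone_sort (hA.eigenvalues ∘ (Fintype.equivFin I).symm)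

theorem toEuclideanLin_eigenvectorBasis {I : Type*} [Fintype I] [DecidableEq I]
    {A : Matrix I I ℂ} (hA : A.IsHermitian) (j : I) :
    toEuclideanLin A (hA.eigenvectorBasis j)
      = (hA.eigenvalues j : ℂ) • hA.eigenvectorBasis j := by
  rw [toLpLin_apply, hA.mulVec_eigenvectorBasis]
  ext
  simp

theorem exists_sorted_eigenbasis {I : Type*} [Fintype I] [DecidableEq I] {A : Matrix I I ℂ}
    (hA : A.IsHermitian) :
    ∃ b : OrthonormalBasis (Fin (Fintype.card I)) ℂ (EuclideanSpace ℂ I),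
      ∀ j, toEuclideanLin A (b j) = (ithEig hA j : ℂ) • b j := by
  refine ⟨hA.eigenvectorBasis.reindex
    ((Tuple.sort (hA.eigenvalues ∘ (Fintype.equivFin I).symm)).trans
      (Fintype.equivFin I).symm).symm, fun j => ?_⟩
  simp only [OrthonormalBasis.reindex_apply, Equiv.symm_symm, Equiv.trans_apply]
  rw [toEuclideanLin_eigenvectorBasis]
  rfl

theorem norm_toEuclideanLin_le {I J : Type*} [Fintype I] [Fintype J] [DecidableEq J]
    (M : Matrix I J ℂ) (x : EuclideanSpace ℂ J) :
    ‖toEuclideanLin M x‖ ≤ specNorm M * ‖x‖ :=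
  (LinearMap.toContinuousLinearMap (toEuclideanLin M)).le_opNorm x

theorem specNorm_nonneg {I J : Type*} [Fintype I] [Fintype J] [DecidableEq J]
    (M : Matrix I J ℂ) : 0 ≤ specNorm M :=
  norm_nonneg _

theorem specNorm_neg {I J : Type*} [Fintype I] [Fintype J] [DecidableEq J]
    (M : Matrix I J ℂ) : specNorm (-M) = specNorm M := by
  simp [specNorm]

theorem specNorm_smul {I J : Type*} [Fintype I] [Fintype J] [DecidableEq J]
    (t : ℝ) (M : Matrix I J ℂ) : specNorm (t • M) = |t| * specNorm M := by
  have h : t • M = (t : ℂ) • M := by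
    ext; simp
  rw [h, specNorm, map_smul, map_smul, norm_smul]
  simp [specNorm]

/-- A symmetric operator applied to `x`, in coordinates of an orthonormal eigenbasis. -/
theorem OrthonormalBasis.inner_eigen_apply {ι V : Type*} [Fintype ι] [NormedAddCommGroup V]
    [InnerProductSpace ℂ V] (b : OrthonormalBasis ι ℂ V) {T : V →ₗ[ℂ] V} (hT : T.IsSymmetric)
    {μ : ι → ℝ} (hb : ∀ j, T (b j) = (μ j : ℂ) • b j) (j : ι) (x : V) :
    inner ℂ (b j) (T x) = (μ j : ℂ) * inner ℂ (b j) x := by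
  rw [← hT, hb, inner_smul_left, Complex.conj_ofReal]

theorem OrthonormalBasis.re_inner_apply_self {ι V : Type*} [Fintype ι] [NormedAddCommGroup V]
    [InnerProductSpace ℂ V] (b : OrthonormalBasis ι ℂ V) {T : V →ₗ[ℂ] V} (hT : T.IsSymmetric)
    {μ : ι → ℝ} (hb : ∀ j, T (b j) = (μ j : ℂ) • b j) (x : V) :
    (inner ℂ x (T x)).re = ∑ j, μ j * ‖inner ℂ (b j) x‖ ^ 2 := by
  rw [← b.sum_inner_mul_inner, Complex.re_sum]
  refine Finset.sum_congr rfl fun j _ => ?_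
  rw [b.inner_eigen_apply hT hb, ← inner_conj_symm x (b j), mul_left_comm,
    Complex.re_ofReal_mul, Complex.conj_mul']
  norm_cast

/-- One half of Weyl's perturbation inequality. -/
theorem ithEig_le_add_specNorm_sub {I : Type*} [Fintype I] [DecidableEq I] {A B : Matrix I I ℂ}
    (hA : A.IsHermitian) (hB : B.IsHermitian) (i : Fin (Fintype.card I)) :
    ithEig hB i ≤ ithEig hA i + specNorm (B - A) := by
  obtain ⟨a, ha⟩ := exists_sorted_eigenbasis hA
  obtain ⟨b, hb⟩ := exists_sorted_eigenbasis hB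
  have hTA := isSymmetric_toEuclideanLin_iff.mpr hA
  have hTB := isSymmetric_toEuclideanLin_iff.mpr hB
  let f : EuclideanSpace ℂ I →ₗ[ℂ] ({j : Fin (Fintype.card I) // j ≠ i} → ℂ) :=
    LinearMap.pi fun j => if i < j.1 then innerₛₗ ℂ (a j) else innerₛₗ ℂ (b j)
  have hker : LinearMap.ker f ≠ ⊥ := by
    apply LinearMap.ker_ne_bot_of_finrank_lt
    have : 0 < Fintype.card I := i.pos
    simp [Fintype.card_subtype_compl]
    omega
  obtain ⟨x, hx, hx0⟩ := Submodule.exists_mem_ne_zero_of_ne_bot hker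
  have hxa : ∀ j, i < j → inner ℂ (a j) x = 0 := fun j hj => by
    simpa [f, hj] using congrFun (LinearMap.mem_ker.mp hx) ⟨j, hj.ne'⟩
  have hxb : ∀ j, j < i → inner ℂ (b j) x = 0 := fun j hj => by
    simpa [f, hj.not_gt] using congrFun (LinearMap.mem_ker.mp hx) ⟨j, hj.ne⟩
  have hpos : 0 < ‖x‖ ^ 2 := by positivity
  have h1 : (inner ℂ x (toEuclideanLin A x)).re ≤ ithEig hA i * ‖x‖ ^ 2 := by
    rw [a.re_inner_apply_self hTA ha, ← a.sum_sq_norm_inner_right x, Finset.mul_sum]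
    refine Finset.sum_le_sum fun j _ => ?_
    rcases lt_or_ge i j with hj | hj
    · simp [hxa j hj]
    · exact mul_le_mul_of_nonneg_right (ithEig_monotone hA hj) (by positivity)
  have h2 : ithEig hB i * ‖x‖ ^ 2 ≤ (inner ℂ x (toEuclideanLin B x)).re := by
    rw [b.re_inner_apply_self hTB hb, ← b.sum_sq_norm_inner_right x, Finset.mul_sum]
    refine Finset.sum_le_sum fun j _ => ?_
    rcases lt_or_ge j i with hj | hj
    · simp [hxb j hj]
    · exact mul_le_mul_of_nonneg_right (ithEig_monotone hB hj) (by positivity)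
  have h3 : (inner ℂ x (toEuclideanLin (B - A) x)).re ≤ specNorm (B - A) * ‖x‖ ^ 2 :=
    calc _ ≤ ‖inner ℂ x (toEuclideanLin (B - A) x)‖ := Complex.re_le_norm _
      _ ≤ ‖x‖ * ‖toEuclideanLin (B - A) x‖ := norm_inner_le_norm _ _
      _ ≤ ‖x‖ * (specNorm (B - A) * ‖x‖) := by gcongr; exact norm_toEuclideanLin_le _ _
      _ = _ := by ring
  rw [map_sub, LinearMap.sub_apply, inner_sub_right, Complex.sub_re] at h3
  refine le_of_mul_le_mul_right ?_ hpos
  linarith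

/-- Weyl's perturbation inequality. -/
theorem abs_ithEig_sub_le {I : Type*} [Fintype I] [DecidableEq I] {A B : Matrix I I ℂ}
    (hA : A.IsHermitian) (hB : B.IsHermitian) (i : Fin (Fintype.card I)) :
    |ithEig hB i - ithEig hA i| ≤ specNorm (B - A) := by
  have h1 := ithEig_le_add_specNorm_sub hA hB i
  have h2 := ithEig_le_add_specNorm_sub hB hA i
  rw [← neg_sub B A, specNorm_neg] at h2
  rw [abs_le]
  constructor <;> linarith

theorem abs_ithEig_add_smul_sub_le {I : Type*} [Fintype I] [DecidableEq I] {A E : Matrix I I ℂ}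
    (h : ∀ t : ℝ, (A + t • E).IsHermitian) (i : Fin (Fintype.card I)) (s t : ℝ) :
    |ithEig (h t) i - ithEig (h s) i| ≤ |t - s| * specNorm E := by
  have := abs_ithEig_sub_le (h s) (h t) i
  rwa [add_sub_add_left_eq_sub, ← sub_smul, specNorm_smul] at this

theorem continuous_ithEig_add_smul {I : Type*} [Fintype I] [DecidableEq I] {A E : Matrix I I ℂ}
    (h : ∀ t : ℝ, (A + t • E).IsHermitian) (i : Fin (Fintype.card I)) :
    Continuous fun t => ithEig (h t) i := by
  refine (LipschitzWith.of_dist_le_mul (K := ⟨specNorm E, specNorm_nonneg E⟩)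
    fun s t => ?_).continuous
  rw [Real.dist_eq, Real.dist_eq, mul_comm]
  exact abs_ithEig_add_smul_sub_le h i t s

theorem toEuclideanLin_add_smul_apply {I : Type*} [Fintype I] [DecidableEq I]
    (A E : Matrix I I ℂ) (t : ℝ) (x : EuclideanSpace ℂ I) :
    toEuclideanLin (A + t • E) x = toEuclideanLin A x + (t : ℂ) • toEuclideanLin E x := by
  have h : t • E = (t : ℂ) • E := by
    ext; simp
  rw [h, map_add, map_smul, LinearMap.add_apply, LinearMap.smul_apply]

/-- For an eigenvalue branch `l` of `T + t • S` continuous at `t`, a bound on the quadratic form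
of `S` at the unit eigenvectors for `l t` controls the difference quotients of `l` at `t`. -/
theorem frequently_abs_sub_lt_of_eigen {V : Type*} [NormedAddCommGroup V]
    [InnerProductSpace ℂ V] [FiniteDimensional ℂ V] {T S : V →ₗ[ℂ] V}
    (hT : T.IsSymmetric) (hS : S.IsSymmetric) {l : ℝ → ℝ} {v : ℝ → V} (hv : ∀ t, ‖v t‖ = 1)
    (heig : ∀ t : ℝ, T (v t) + (t : ℂ) • S (v t) = (l t : ℂ) • v t) {t : ℝ}
    (hl : ContinuousAt l t) {C r : ℝ}
    (hC : ∀ y, ‖y‖ = 1 → T y + (t : ℂ) • S y = (l t : ℂ) • y → ‖inner ℂ y (S y)‖ ≤ C)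
    (hr : C < r) :
    ∃ᶠ z in 𝓝[>] t, |l z - l t| < r * (z - t) := by
  have : ProperSpace V := FiniteDimensional.proper ℂ V
  obtain ⟨s, -, hst, hs⟩ := exists_seq_strictAnti_tendsto t
  obtain ⟨y, hy, φ, hφ, hlim⟩ := (isCompact_sphere (0 : V) 1).tendsto_subseq
    (x := fun n => v (s n)) (fun n => by simp [hv])
  have hs' : Tendsto (s ∘ φ) atTop (𝓝 t) := hs.comp hφ.tendsto_atTop
  have hy1 : ‖y‖ = 1 := by simpa using hy
  have hTc : Continuous T := T.continuous_of_finiteDimensional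
  have hSc : Continuous S := S.continuous_of_finiteDimensional
  have hSlim : Tendsto (fun n => S (v (s (φ n)))) atTop (𝓝 (S y)) :=
    (hSc.tendsto y).comp hlim
  have hyeig : T y + (t : ℂ) • S y = (l t : ℂ) • y := by
    have h1 : Tendsto (fun n => T (v (s (φ n))) + (s (φ n) : ℂ) • S (v (s (φ n)))) atTop
        (𝓝 (T y + (t : ℂ) • S y)) :=
      ((hTc.tendsto y).comp hlim).add
        (((Complex.continuous_ofReal.tendsto t).comp hs').smul hSlim)
    have h2 : Tendsto (fun n => (l (s (φ n)) : ℂ) • v (s (φ n))) atTop (𝓝 ((l t : ℂ) • y)) :=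
      ((Complex.continuous_ofReal.tendsto _).comp (hl.tendsto.comp hs')).smul hlim
    simp only [heig] at h1
    exact tendsto_nhds_unique h1 h2
  have hnum : Tendsto (fun n => ‖inner ℂ y (S (v (s (φ n))))‖) atTop (𝓝 ‖inner ℂ y (S y)‖) :=
    (tendsto_const_nhds.inner hSlim).norm
  have hden : Tendsto (fun n => r * ‖inner ℂ y (v (s (φ n)))‖) atTop (𝓝 r) := by
    have h := ((tendsto_const_nhds (x := y)).inner (𝕜 := ℂ) hlim).norm.const_mul r
    simpa [inner_self_eq_norm_sq_to_K, hy1] using h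
  have hlt := hnum.eventually_lt hden ((hC y hy1 hyeig).trans_lt hr)
  have hmem : Tendsto (s ∘ φ) atTop (𝓝[>] t) :=
    tendsto_nhdsWithin_iff.mpr ⟨hs', Eventually.of_forall fun n => hst (φ n)⟩
  refine hmem.frequently (Eventually.frequently ?_)
  filter_upwards [hlt] with n hn
  set z := s (φ n)
  have hzt : 0 < z - t := sub_pos.mpr (hst (φ n))
  have key : ((l z - l t : ℝ) : ℂ) * inner ℂ y (v z)
      = ((z - t : ℝ) : ℂ) * inner ℂ y (S (v z)) := by
    have h1 := congrArg (inner ℂ y) (heig z)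
    have h2 := congrArg (fun w => inner ℂ w (v z)) hyeig
    simp only [inner_add_right, inner_smul_right, inner_add_left, inner_smul_left,
      Complex.conj_ofReal, hT y (v z), hS y (v z)] at h1 h2
    push_cast
    linear_combination h2 - h1
  have key' := congrArg norm key
  rw [norm_mul, norm_mul, Complex.norm_real, Complex.norm_real, Real.norm_eq_abs,
    Real.norm_eq_abs, abs_of_pos hzt] at key'
  have h3 : |l z - l t| * ‖inner ℂ y (v z)‖ < r * (z - t) * ‖inner ℂ y (v z)‖ := by
    rw [key']
    calc _ < (z - t) * (r * ‖inner ℂ y (v z)‖) := by gcongr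
      _ = _ := by ring
  exact lt_of_mul_lt_mul_right h3 (norm_nonneg _)

theorem abs_sub_le_of_frequently {l : ℝ → ℝ} {C a b : ℝ} (hab : a ≤ b)
    (hl : ContinuousOn l (Set.Icc a b))
    (h : ∀ t ∈ Set.Ico a b, ∀ r, C < r → ∃ᶠ z in 𝓝[>] t, |l z - l t| < r * (z - t)) :
    |l b - l a| ≤ C * (b - a) := by
  refine image_le_of_liminf_slope_right_le_deriv_boundary (f := fun t => |l t - l a|)
    (B := fun t => C * (t - a)) (B' := fun _ => C) (hl.sub continuousOn_const).abs (by simp)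
    (by fun_prop) (fun t _ => ?_) (fun t ht r hr => ?_) (Set.right_mem_Icc.mpr hab)
  · simpa using (((hasDerivAt_id t).sub_const a).const_mul C).hasDerivWithinAt
  · refine ((h t ht r hr).and_eventually self_mem_nhdsWithin).mono fun z hz => ?_
    have hzt : 0 < z - t := sub_pos.mpr hz.2
    rw [slope_def_field, div_lt_iff₀ hzt]
    refine lt_of_le_of_lt ?_ hz.1
    simpa using abs_sub_abs_le_abs_sub (l z - l a) (l t - l a)

/-- The distance from a real number to the spectrum of a Hermitian matrix bounds the shifted
matrix from below. -/
theorem gap_mul_norm_le {I : Type*} [Fintype I] [DecidableEq I] {A : Matrix I I ℂ}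
    (hA : A.IsHermitian) (c : ℝ) {δ : ℝ} (hδ : 0 ≤ δ) (h : ∀ j, δ ≤ |c - hA.eigenvalues j|)
    (x : EuclideanSpace ℂ I) :
    δ * ‖x‖ ≤ ‖toEuclideanLin A x - (c : ℂ) • x‖ := by
  have hT := isSymmetric_toEuclideanLin_iff.mpr hA
  refine le_of_sq_le_sq ?_ (norm_nonneg _)
  rw [mul_pow, ← hA.eigenvectorBasis.sum_sq_norm_inner_right x,
    ← hA.eigenvectorBasis.sum_sq_norm_inner_right, Finset.mul_sum]
  refine Finset.sum_le_sum fun j _ => ?_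
  rw [inner_sub_right, inner_smul_right,
    hA.eigenvectorBasis.inner_eigen_apply hT (toEuclideanLin_eigenvectorBasis hA), ← sub_mul,
    norm_mul, mul_pow, ← Complex.ofReal_sub, Complex.norm_real, Real.norm_eq_abs, abs_sub_comm]
  gcongr
  exact h j

/-- The first block of a vector indexed by a sum type. -/
def fstBlock {I J : Type*} (x : EuclideanSpace ℂ (I ⊕ J)) : EuclideanSpace ℂ I :=
  WithLp.toLp 2 fun i => x (Sum.inl i)

/-- The second block of a vector indexed by a sum type. -/
def sndBlock {I J : Type*} (x : EuclideanSpace ℂ (I ⊕ J)) : EuclideanSpace ℂ J :=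
  WithLp.toLp 2 fun j => x (Sum.inr j)

section Blocks

variable {I J : Type*} [Fintype I] [Fintype J]

theorem norm_sq_eq_blocks (x : EuclideanSpace ℂ (I ⊕ J)) :
    ‖x‖ ^ 2 = ‖fstBlock x‖ ^ 2 + ‖sndBlock x‖ ^ 2 := by
  simp [EuclideanSpace.norm_sq_eq, Fintype.sum_sum_type, fstBlock, sndBlock]

theorem inner_eq_blocks (x y : EuclideanSpace ℂ (I ⊕ J)) :
    inner ℂ x y = inner ℂ (fstBlock x) (fstBlock y) + inner ℂ (sndBlock x) (sndBlock y) := by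
  simp [PiLp.inner_apply, Fintype.sum_sum_type, fstBlock, sndBlock]

variable [DecidableEq I] [DecidableEq J]

theorem fstBlock_fromBlocks (P : Matrix I I ℂ) (Q : Matrix I J ℂ) (R : Matrix J I ℂ)
    (S : Matrix J J ℂ) (x : EuclideanSpace ℂ (I ⊕ J)) :
    fstBlock (toEuclideanLin (fromBlocks P Q R S) x)
      = toEuclideanLin P (fstBlock x) + toEuclideanLin Q (sndBlock x) := by
  ext i
  simp [fstBlock, sndBlock, toLpLin_apply, mulVec, dotProduct, Fintype.sum_sum_type]

theorem sndBlock_fromBlocks (P : Matrix I I ℂ) (Q : Matrix I J ℂ) (R : Matrix J I ℂ)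
    (S : Matrix J J ℂ) (x : EuclideanSpace ℂ (I ⊕ J)) :
    sndBlock (toEuclideanLin (fromBlocks P Q R S) x)
      = toEuclideanLin R (fstBlock x) + toEuclideanLin S (sndBlock x) := by
  ext i
  simp [fstBlock, sndBlock, toLpLin_apply, mulVec, dotProduct, Fintype.sum_sum_type]

theorem specNorm_le_specNorm_fromBlocks (P : Matrix I I ℂ) (Q : Matrix I J ℂ) (R : Matrix J I ℂ)
    (S : Matrix J J ℂ) : specNorm S ≤ specNorm (fromBlocks P Q R S) := by
  refine ContinuousLinearMap.opNorm_le_bound _ (specNorm_nonneg _) fun x => ?_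
  let w : EuclideanSpace ℂ (I ⊕ J) := WithLp.toLp 2 (Sum.elim 0 x)
  have hw1 : fstBlock w = 0 := by ext; simp [fstBlock, w]
  have hw2 : sndBlock w = x := by ext; simp [sndBlock, w]
  have hw : ‖w‖ = ‖x‖ := by
    have := norm_sq_eq_blocks w
    rw [hw1, hw2, norm_zero, zero_pow two_ne_zero, zero_add] at this
    exact (sq_eq_sq₀ (norm_nonneg _) (norm_nonneg _)).mp this
  have hS : sndBlock (toEuclideanLin (fromBlocks P Q R S) w) = toEuclideanLin S x := by
    rw [sndBlock_fromBlocks, hw1, hw2, map_zero, zero_add]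
  rw [LinearMap.coe_toContinuousLinearMap', ← hS, ← hw]
  refine le_trans ?_ (norm_toEuclideanLin_le _ w)
  refine le_of_sq_le_sq ?_ (norm_nonneg _)
  rw [norm_sq_eq_blocks (toEuclideanLin _ w)]
  exact le_add_of_nonneg_left (sq_nonneg _)

theorem norm_inner_toEuclideanLin_le {I J : Type*} [Fintype I] [Fintype J] [DecidableEq J]
    (M : Matrix I J ℂ) (x : EuclideanSpace ℂ I) (y : EuclideanSpace ℂ J) :
    ‖inner ℂ x (toEuclideanLin M y)‖ ≤ specNorm M * ‖y‖ * ‖x‖ :=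
  calc _ ≤ ‖x‖ * ‖toEuclideanLin M y‖ := norm_inner_le_norm _ _
    _ ≤ ‖x‖ * (specNorm M * ‖y‖) := by gcongr; exact norm_toEuclideanLin_le _ _
    _ = _ := by ring

theorem norm_inner_fromBlocks_le (P : Matrix I I ℂ) (R : Matrix J I ℂ) (S : Matrix J J ℂ)
    (x : EuclideanSpace ℂ (I ⊕ J)) :
    ‖inner ℂ x (toEuclideanLin (fromBlocks P Rᴴ R S) x)‖
      ≤ specNorm P * ‖fstBlock x‖ ^ 2 + 2 * specNorm R * (‖fstBlock x‖ * ‖sndBlock x‖)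
        + specNorm S * ‖sndBlock x‖ ^ 2 := by
  rw [inner_eq_blocks, fstBlock_fromBlocks, sndBlock_fromBlocks, inner_add_right, inner_add_right]
  have h1 := norm_inner_toEuclideanLin_le P (fstBlock x) (fstBlock x)
  have h2 : ‖inner ℂ (fstBlock x) (toEuclideanLin Rᴴ (sndBlock x))‖
      ≤ specNorm R * ‖fstBlock x‖ * ‖sndBlock x‖ := by
    rw [toEuclideanLin_conjTranspose_eq_adjoint, LinearMap.adjoint_inner_right, norm_inner_symm]
    exact norm_inner_toEuclideanLin_le R _ _
  have h3 := norm_inner_toEuclideanLin_le R (sndBlock x) (fstBlock x)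
  have h4 := norm_inner_toEuclideanLin_le S (sndBlock x) (sndBlock x)
  refine (norm_add_le _ _).trans ((add_le_add (norm_add_le _ _) (norm_add_le _ _)).trans ?_)
  nlinarith

/-- The tail of a unit eigenvector of `A + t • E` whose eigenvalue is close to a number far from
the spectrum of the trailing block of `A`. -/
theorem norm_sndBlock_le (A11 E11 : Matrix I I ℂ) (A12 E12 : Matrix I J ℂ)
    (A21 E21 : Matrix J I ℂ) {A22 : Matrix J J ℂ} (E22 : Matrix J J ℂ) (hA22 : A22.IsHermitian)
    {c δ ε t l : ℝ} (hδ : ∀ j, δ ≤ |c - hA22.eigenvalues j|) (ht : t ∈ Set.Icc (0 : ℝ) 1)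
    (hl : |l - c| ≤ ε) (hE : specNorm E22 ≤ ε) (hgap : 2 * ε < δ)
    {x : EuclideanSpace ℂ (I ⊕ J)} (hx : ‖x‖ = 1)
    (heig : toEuclideanLin (fromBlocks A11 A12 A21 A22) x
      + (t : ℂ) • toEuclideanLin (fromBlocks E11 E12 E21 E22) x = (l : ℂ) • x) :
    ‖fstBlock x‖ ≤ 1 ∧ ‖sndBlock x‖ ≤ (specNorm A21 + specNorm E21) / (δ - 2 * ε) := by
  have hsq := norm_sq_eq_blocks x
  have h1 : ‖fstBlock x‖ ≤ 1 := by
    rw [hx] at hsq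
    nlinarith [sq_nonneg ‖sndBlock x‖, norm_nonneg (fstBlock x)]
  refine ⟨h1, ?_⟩
  have hε : 0 ≤ ε := (abs_nonneg _).trans hl
  rw [le_div_iff₀ (by linarith)]
  set x1 := fstBlock x
  set x2 := sndBlock x
  have h2 : toEuclideanLin A21 x1 + toEuclideanLin A22 x2
      + (t : ℂ) • (toEuclideanLin E21 x1 + toEuclideanLin E22 x2) = (l : ℂ) • x2 := by
    rw [← sndBlock_fromBlocks A11 A12, ← sndBlock_fromBlocks E11 E12]
    exact congrArg sndBlock heig
  have h3 : toEuclideanLin A22 x2 - (c : ℂ) • x2 = ((l - c : ℝ) : ℂ) • x2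
      - (t : ℂ) • toEuclideanLin E22 x2 - toEuclideanLin A21 x1
      - (t : ℂ) • toEuclideanLin E21 x1 := by
    rw [Complex.ofReal_sub, sub_smul, ← h2, smul_add]
    abel
  have h4 := gap_mul_norm_le hA22 c (by linarith) hδ x2
  have htn : ‖(t : ℂ)‖ ≤ 1 := by
    rw [Complex.norm_real, Real.norm_eq_abs, abs_of_nonneg ht.1]
    exact ht.2
  have h5 : ‖((l - c : ℝ) : ℂ) • x2‖ ≤ ε * ‖x2‖ := by
    rw [norm_smul, Complex.norm_real, Real.norm_eq_abs]
    gcongr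
  have hsmul : ∀ w : EuclideanSpace ℂ J, ‖(t : ℂ) • w‖ ≤ ‖w‖ := fun w => by
    rw [norm_smul]
    exact mul_le_of_le_one_left (norm_nonneg _) htn
  have h6 : ‖(t : ℂ) • toEuclideanLin E22 x2‖ ≤ ε * ‖x2‖ :=
    (hsmul _).trans ((norm_toEuclideanLin_le _ _).trans (by gcongr))
  have h7 : ‖toEuclideanLin A21 x1‖ ≤ specNorm A21 :=
    (norm_toEuclideanLin_le _ _).trans (mul_le_of_le_one_right (specNorm_nonneg _) h1)
  have h8 : ‖(t : ℂ) • toEuclideanLin E21 x1‖ ≤ specNorm E21 :=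
    (hsmul _).trans ((norm_toEuclideanLin_le _ _).trans
      (mul_le_of_le_one_right (specNorm_nonneg _) h1))
  rw [h3] at h4
  have h9 := norm_sub_le (((l - c : ℝ) : ℂ) • x2 - (t : ℂ) • toEuclideanLin E22 x2
    - toEuclideanLin A21 x1) ((t : ℂ) • toEuclideanLin E21 x1)
  have h10 := norm_sub_le (((l - c : ℝ) : ℂ) • x2 - (t : ℂ) • toEuclideanLin E22 x2)
    (toEuclideanLin A21 x1)
  have h11 := norm_sub_le (((l - c : ℝ) : ℂ) • x2) ((t : ℂ) • toEuclideanLin E22 x2)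
  linarith

end Blocks

/-- Theorem 1 (main 2×2 block perturbation bound). -/
theorem stmt_2 {m k : ℕ}
    (A11 : Matrix (Fin m) (Fin m) ℂ) (A21 : Matrix (Fin k) (Fin m) ℂ)
    (A22 : Matrix (Fin k) (Fin k) ℂ)
    (E11 : Matrix (Fin m) (Fin m) ℂ) (E21 : Matrix (Fin k) (Fin m) ℂ)
    (E22 : Matrix (Fin k) (Fin k) ℂ)
    (A : Matrix (Fin m ⊕ Fin k) (Fin m ⊕ Fin k) ℂ) (hAdef : A = fromBlocks A11 A21ᴴ A21 A22)
    (E : Matrix (Fin m ⊕ Fin k) (Fin m ⊕ Fin k) ℂ) (hEdef : E = fromBlocks E11 E21ᴴ E21 E22)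
    (hA : A.IsHermitian) (hA22 : A22.IsHermitian) (hAE : (A + E).IsHermitian)
    (htE : ∀ t : ℝ, (A + t • E).IsHermitian)
    (i : Fin (Fintype.card (Fin m ⊕ Fin k)))
    (hgap : (⨅ j, |ithEig hA i - hA22.eigenvalues j|) > 2 * specNorm E)
    (hsimple : ∀ t ∈ Set.Icc (0:ℝ) 1,
      Module.finrank ℂ (Module.End.eigenspace (Matrix.toEuclideanLin (A + t • E))
        ((ithEig (htE t) i : ℝ) : ℂ)) = 1) :
    |ithEig hA i - ithEig hAE i| ≤
      specNorm E11
      + 2 * specNorm E21 *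
        ((specNorm A21 + specNorm E21) /
          ((⨅ j, |ithEig hA i - hA22.eigenvalues j|) - 2 * specNorm E))
      + specNorm E22 *
        ((specNorm A21 + specNorm E21) /
          ((⨅ j, |ithEig hA i - hA22.eigenvalues j|) - 2 * specNorm E)) ^ 2 := by
  have hE : E.IsHermitian := by
    simpa using (htE 1).sub hA
  have h0 : ithEig hA i = ithEig (htE 0) i := ithEig_congr _ _ (by simp) i
  have h1 : ithEig hAE i = ithEig (htE 1) i := ithEig_congr _ _ (by simp) i
  set δ := ⨅ j, |ithEig hA i - hA22.eigenvalues j|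
  have hδle : ∀ j, δ ≤ |ithEig hA i - hA22.eigenvalues j| := fun j =>
    ciInf_le (Set.finite_range _).bddBelow j
  set τ := (specNorm A21 + specNorm E21) / (δ - 2 * specNorm E)
  have hvec : ∀ t : ℝ, ∃ v : EuclideanSpace ℂ (Fin m ⊕ Fin k), ‖v‖ = 1 ∧
      toEuclideanLin A v + (t : ℂ) • toEuclideanLin E v = (ithEig (htE t) i : ℂ) • v :=
    fun t => by
      obtain ⟨b, hb⟩ := exists_sorted_eigenbasis (htE t)
      exact ⟨b i, b.norm_eq_one i, by rw [← toEuclideanLin_add_smul_apply, hb]⟩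
  choose v hv heig using hvec
  have hcont := continuous_ithEig_add_smul htE i
  have main := abs_sub_le_of_frequently (C := specNorm E11 + 2 * specNorm E21 * τ
      + specNorm E22 * τ ^ 2) zero_le_one hcont.continuousOn fun t ht r hr =>
    frequently_abs_sub_lt_of_eigen (isSymmetric_toEuclideanLin_iff.mpr hA)
      (isSymmetric_toEuclideanLin_iff.mpr hE) hv heig hcont.continuousAt
      (fun y hy hyeig => ?_) hr
  · rw [h0, h1, abs_sub_comm]
    simpa using main
  have hl : |ithEig (htE t) i - ithEig hA i| ≤ specNorm E := by
    rw [h0]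
    refine (abs_ithEig_add_smul_sub_le htE i 0 t).trans
      (mul_le_of_le_one_left (specNorm_nonneg _) ?_)
    rw [sub_zero, abs_of_nonneg ht.1]
    exact ht.2.le
  have hE22 : specNorm E22 ≤ specNorm E := by
    rw [hEdef]
    exact specNorm_le_specNorm_fromBlocks _ _ _ _
  obtain ⟨hy1, hy2⟩ := norm_sndBlock_le A11 E11 A21ᴴ E21ᴴ A21 E21 E22 hA22 hδle
    (Set.Ico_subset_Icc_self ht) hl hE22 hgap hy (by rw [← hAdef, ← hEdef]; exact hyeig)
  rw [hEdef]
  refine (norm_inner_fromBlocks_le E11 E21 E22 y).trans ?_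
  have n1 := specNorm_nonneg E11
  have n2 := specNorm_nonneg E21
  have n3 := specNorm_nonneg E22
  have hprod : ‖fstBlock y‖ * ‖sndBlock y‖ ≤ τ :=
    (mul_le_of_le_one_left (norm_nonneg _) hy1).trans hy2
  have hfst : ‖fstBlock y‖ ^ 2 ≤ 1 := pow_le_one₀ (norm_nonneg _) hy1
  gcongr
  exact mul_le_of_le_one_right n1 hfst
end

section
/- Let A11 be a nonsingular Hermitian (n−1)×(n−1) matrix, δ ∈ ℝ, and v a fixed unit vector in ℂ^{n−1}. Consider the n×n Hermitian matrices M_ε = [[A11, δv],[δv^H, ε]] and M_0 = [[A11, δv],[δv^H, 0]]. Then as (ε, δ) → 0, the n−1 eigenvalues of M_ε closest to those of A11 differ from the corresponding eigenvalues of M_0 by O(ε δ²), while the remaining eigenvalue differs by at most |ε|. -/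
open Matrix

/-- The bordered matrix `[[A11, δv],[δvᴴ, ε]]`. -/
noncomputable def borderedMat {m : ℕ} (A11 : Matrix (Fin m) (Fin m) ℂ)
    (v : Fin m → ℂ) (ε δ : ℝ) : Matrix (Fin m ⊕ Fin 1) (Fin m ⊕ Fin 1) ℂ :=
  fromBlocks A11 (Matrix.of fun i (_ : Fin 1) => (δ : ℂ) * v i)
    (Matrix.of fun (_ : Fin 1) j => (δ : ℂ) * star (v j))
    (Matrix.of fun (_ : Fin 1) (_ : Fin 1) => (ε : ℂ))

theorem le_of_quadratic_le {n : ℕ} {E : Type*} [NormedAddCommGroup E] [InnerProductSpace ℂ E]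
    (b c : OrthonormalBasis (Fin n) ℂ E) (S T : E →ₗ[ℂ] E) (p q : Fin n → ℝ)
    (hp : Monotone p) (hq : Monotone q) (hS : ∀ i, S (b i) = (p i : ℂ) • b i)
    (hT : ∀ i, T (c i) = (q i : ℂ) • c i) (t : ℝ)
    (h : ∀ x, (inner ℂ x (S x)).re ≤ (inner ℂ x (T x)).re + t * ‖x‖ ^ 2) (i : Fin n) :
    p i ≤ q i + t := by
  have quad : ∀ (b : OrthonormalBasis (Fin n) ℂ E) (S : E →ₗ[ℂ] E) (p : Fin n → ℝ)
      (_ : ∀ i, S (b i) = (p i : ℂ) • b i) (x : E),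
      (inner ℂ x (S x)).re = ∑ j, p j * ‖inner ℂ (b j) x‖ ^ 2 := by
    intro b S p hS x
    have h1 : S x = ∑ j, (inner ℂ (b j) x * (p j : ℂ)) • b j := by
      conv_lhs => rw [← b.sum_repr' x]
      simp only [map_sum, map_smul, hS, smul_smul]
    rw [h1, inner_sum, Complex.re_sum]
    refine Finset.sum_congr rfl fun j _ => ?_
    rw [inner_smul_right, ← inner_conj_symm x (b j)]
    have : inner ℂ (b j) x * (p j : ℂ) * (starRingEnd ℂ) (inner ℂ (b j) x)
        = ((p j * ‖inner ℂ (b j) x‖ ^ 2 : ℝ) : ℂ) := by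
      rw [mul_right_comm, Complex.mul_conj']
      push_cast; ring
    rw [this, Complex.ofReal_re]
  have : FiniteDimensional ℂ E := b.toBasis.finiteDimensional_of_finite
  let L : E →ₗ[ℂ] ({j : Fin n // j ≠ i} → ℂ) := LinearMap.pi fun j =>
    if j.1 < i then (innerSL ℂ (b j.1)).toLinearMap else (innerSL ℂ (c j.1)).toLinearMap
  have hL : L.ker ≠ ⊥ := by
    apply LinearMap.ker_ne_bot_of_finrank_lt
    rw [Module.finrank_eq_card_basis b.toBasis, Module.finrank_fintype_fun_eq_card]
    exact Fintype.card_subtype_lt (x := i) (by simp)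
  obtain ⟨x, hx, hx0⟩ := (Submodule.ne_bot_iff _).1 hL
  have hx' : ∀ j (hj : j ≠ i), L x ⟨j, hj⟩ = 0 := fun j hj => by
    rw [LinearMap.mem_ker.1 hx]; rfl
  have hb : ∀ j, j < i → inner ℂ (b j) x = 0 := fun j hj => by
    simpa [L, hj] using hx' j hj.ne
  have hc : ∀ j, i < j → inner ℂ (c j) x = 0 := fun j hj => by
    simpa [L, hj.not_gt] using hx' j hj.ne'
  have h1 : p i * ‖x‖ ^ 2 ≤ (inner ℂ x (S x)).re := by
    rw [quad b S p hS, ← b.sum_sq_norm_inner_right x, Finset.mul_sum]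
    refine Finset.sum_le_sum fun j _ => ?_
    rcases lt_or_ge j i with hj | hj
    · simp [hb j hj]
    · exact mul_le_mul_of_nonneg_right (hp hj) (by positivity)
  have h2 : (inner ℂ x (T x)).re ≤ q i * ‖x‖ ^ 2 := by
    rw [quad c T q hT, ← c.sum_sq_norm_inner_right x, Finset.mul_sum]
    refine Finset.sum_le_sum fun j _ => ?_
    rcases lt_or_ge i j with hj | hj
    · simp [hc j hj]
    · exact mul_le_mul_of_nonneg_right (hq hj) (by positivity)
  have h3 : 0 < ‖x‖ ^ 2 := by positivity
  have := h x
  nlinarith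
section SortedEigenvalues

variable {I : Type*} [Fintype I] [DecidableEq I] {A B : Matrix I I ℂ}

/-- An orthonormal eigenbasis, ordered by increasing eigenvalue. -/
noncomputable def sortedEigenbasis (hA : A.IsHermitian) :
    OrthonormalBasis (Fin (Fintype.card I)) ℂ (EuclideanSpace ℂ I) :=
  hA.eigenvectorBasis.reindex ((Fintype.equivFin I).trans
    (Tuple.sort (hA.eigenvalues ∘ (Fintype.equivFin I).symm)).symm)

theorem toEuclideanLin_sortedEigenbasis (hA : A.IsHermitian) (i : Fin (Fintype.card I)) :
    toEuclideanLin A (sortedEigenbasis hA i) = (ithEig hA i : ℂ) • sortedEigenbasis hA i := by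
  simp only [sortedEigenbasis, OrthonormalBasis.reindex_apply, toLpLin_apply,
    Matrix.IsHermitian.mulVec_eigenvectorBasis]
  rfl

theorem ithEig_monotone_s10 (hA : A.IsHermitian) : Monotone (ithEig hA) :=
  Tuple.monotone_sort _

/-- Weyl's inequality for sorted eigenvalues. -/
theorem ithEig_le_add (hA : A.IsHermitian) (hB : B.IsHermitian) (t : ℝ)
    (h : ∀ x, (inner ℂ x (toEuclideanLin A x)).re
      ≤ (inner ℂ x (toEuclideanLin B x)).re + t * ‖x‖ ^ 2) (i : Fin (Fintype.card I)) :
    ithEig hA i ≤ ithEig hB i + t :=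
  le_of_quadratic_le (sortedEigenbasis hA) (sortedEigenbasis hB) _ _ _ _
    (ithEig_monotone_s10 hA) (ithEig_monotone_s10 hB) (toEuclideanLin_sortedEigenbasis hA)
    (toEuclideanLin_sortedEigenbasis hB) t h i

theorem sum_ithEig (hA : A.IsHermitian) : ∑ i, ithEig hA i = A.trace.re := by
  rw [hA.trace_eq_sum_eigenvalues, Complex.re_sum]
  exact Fintype.sum_equiv ((Tuple.sort (hA.eigenvalues ∘ (Fintype.equivFin I).symm)).trans
    (Fintype.equivFin I).symm) _ _ fun _ => rfl

theorem exists_ithEig_eq_zero (hA : A.IsHermitian) (h : A.det = 0) : ∃ k, ithEig hA k = 0 := by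
  rw [hA.det_eq_prod_eigenvalues, Finset.prod_eq_zero_iff] at h
  obtain ⟨j, -, hj⟩ := h
  refine ⟨((Tuple.sort (hA.eigenvalues ∘ (Fintype.equivFin I).symm)).trans
    (Fintype.equivFin I).symm).symm j, ?_⟩
  simp only [ithEig, Function.comp_apply, Equiv.symm_trans_apply, Equiv.apply_symm_apply,
    Equiv.symm_symm, Equiv.symm_apply_apply]
  exact Complex.ofReal_eq_zero.1 hj

end SortedEigenvalues

section Bordered

variable {m : ℕ}

/-- The leading block of a vector indexed by `Fin m ⊕ Fin 1`. -/
noncomputable def topPart (u : EuclideanSpace ℂ (Fin m ⊕ Fin 1)) : EuclideanSpace ℂ (Fin m) :=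
  WithLp.toLp 2 fun i => u (Sum.inl i)

theorem inner_eq_inner_topPart_add (u w : EuclideanSpace ℂ (Fin m ⊕ Fin 1)) :
    inner ℂ u w = inner ℂ (topPart u) (topPart w)
      + w (Sum.inr 0) * star (u (Sum.inr 0)) := by
  simp [PiLp.inner_apply, Fintype.sum_sum_type, topPart]

theorem norm_sq_eq_topPart_add (u : EuclideanSpace ℂ (Fin m ⊕ Fin 1)) :
    ‖u‖ ^ 2 = ‖topPart u‖ ^ 2 + ‖u (Sum.inr 0)‖ ^ 2 := by
  simp [EuclideanSpace.norm_sq_eq, Fintype.sum_sum_type, topPart]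

variable (A : Matrix (Fin m) (Fin m) ℂ) (v : Fin m → ℂ) (ε δ : ℝ)
  (u : EuclideanSpace ℂ (Fin m ⊕ Fin 1))

theorem topPart_borderedMat :
    topPart (toEuclideanLin (borderedMat A v ε δ) u) = toEuclideanLin A (topPart u)
      + ((δ : ℂ) * u (Sum.inr 0)) • WithLp.toLp 2 v := by
  ext i
  simp [topPart, toLpLin_apply, borderedMat, mulVec, dotProduct, Fintype.sum_sum_type]
  ring

theorem borderedMat_apply_inr :
    toEuclideanLin (borderedMat A v ε δ) u (Sum.inr 0)
      = (δ : ℂ) * inner ℂ (WithLp.toLp 2 v) (topPart u) + ε * u (Sum.inr 0) := by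
  simp [topPart, toLpLin_apply, borderedMat, mulVec, dotProduct, Fintype.sum_sum_type,
    PiLp.inner_apply, Finset.mul_sum]
  exact Finset.sum_congr rfl fun _ _ => by ring

theorem re_inner_borderedMat :
    (inner ℂ u (toEuclideanLin (borderedMat A v ε δ) u)).re
      = (inner ℂ (topPart u) (toEuclideanLin A (topPart u))).re
        + 2 * δ * (star (u (Sum.inr 0)) * inner ℂ (WithLp.toLp 2 v) (topPart u)).re
        + ε * ‖u (Sum.inr 0)‖ ^ 2 := by
  rw [inner_eq_inner_topPart_add, topPart_borderedMat, borderedMat_apply_inr, inner_add_right,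
    inner_smul_right, ← inner_conj_symm (topPart u) (WithLp.toLp 2 v), ← Complex.normSq_eq_norm_sq,
    Complex.normSq_apply]
  generalize inner ℂ (WithLp.toLp 2 v) (topPart u) = z
  simp
  ring

variable {v}

theorem abs_re_cross_le (hv : ‖WithLp.toLp 2 v‖ = 1) :
    |2 * (star (u (Sum.inr 0)) * inner ℂ (WithLp.toLp 2 v) (topPart u)).re| ≤ ‖u‖ ^ 2 := by
  have h1 := Complex.abs_re_le_norm (star (u (Sum.inr 0)) * inner ℂ (WithLp.toLp 2 v) (topPart u))
  have h2 := norm_inner_le_norm (𝕜 := ℂ) (WithLp.toLp 2 v) (topPart u)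
  rw [hv, one_mul] at h2
  rw [norm_mul, norm_star] at h1
  rw [norm_sq_eq_topPart_add, abs_mul, abs_two]
  have := mul_le_mul_of_nonneg_left h2 (norm_nonneg (u (Sum.inr 0)))
  nlinarith [sq_nonneg (‖topPart u‖ - ‖u (Sum.inr 0)‖)]

variable {A ε δ u}

theorem norm_topPart_le (hv : ‖WithLp.toLp 2 v‖ = 1) {K : ℝ} (hK : 0 ≤ K)
    (hA : ∀ x, ‖x‖ ≤ K * ‖toEuclideanLin A x‖) {l : ℝ} (hl : K * |l| ≤ 1 / 2)
    (h : toEuclideanLin (borderedMat A v ε δ) u = (l : ℂ) • u) :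
    ‖topPart u‖ ≤ 2 * K * |δ| * ‖u (Sum.inr 0)‖ := by
  have h1 : toEuclideanLin A (topPart u)
      = (l : ℂ) • topPart u - ((δ : ℂ) * u (Sum.inr 0)) • WithLp.toLp 2 v := by
    rw [eq_sub_iff_add_eq, ← topPart_borderedMat A v ε δ u, h]
    rfl
  have h2 : ‖toEuclideanLin A (topPart u)‖ ≤ |l| * ‖topPart u‖ + |δ| * ‖u (Sum.inr 0)‖ := by
    rw [h1]
    refine (norm_sub_le _ _).trans ?_
    rw [norm_smul, norm_smul, hv, norm_mul]
    simp
  have h3 := (hA (topPart u)).trans (mul_le_mul_of_nonneg_left h2 hK)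
  have h4 := mul_le_mul_of_nonneg_right hl (norm_nonneg (topPart u))
  linarith

/-- The biorthogonal identity for eigenvectors of two bordered matrices that differ in the
corner entry. -/
theorem sub_mul_inner_eigenvectors {w : EuclideanSpace ℂ (Fin m ⊕ Fin 1)} {l k : ℝ}
    (h0 : (borderedMat A v 0 δ).IsHermitian)
    (hu : toEuclideanLin (borderedMat A v ε δ) u = (l : ℂ) • u)
    (hw : toEuclideanLin (borderedMat A v 0 δ) w = (k : ℂ) • w) :
    ((l : ℂ) - k) * inner ℂ w u = ε * (u (Sum.inr 0) * star (w (Sum.inr 0))) := by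
  have h1 : inner ℂ w (toEuclideanLin (borderedMat A v ε δ) u)
      = inner ℂ w (toEuclideanLin (borderedMat A v 0 δ) u)
        + ε * (u (Sum.inr 0) * star (w (Sum.inr 0))) := by
    simp only [inner_eq_inner_topPart_add, topPart_borderedMat, borderedMat_apply_inr]
    push_cast
    ring
  have h2 := (isSymmetric_toEuclideanLin_iff.2 h0) w u
  rw [hu, ← h2, hw, inner_smul_right, inner_smul_left, Complex.conj_ofReal] at h1
  linear_combination h1

theorem abs_eigenvalue_sub_sub_le (hv : ‖WithLp.toLp 2 v‖ = 1) {K : ℝ} (hK : 0 ≤ K)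
    (hA : ∀ x, ‖x‖ ≤ K * ‖toEuclideanLin A x‖) {w : EuclideanSpace ℂ (Fin m ⊕ Fin 1)} {l k : ℝ}
    (h0 : (borderedMat A v 0 δ).IsHermitian) (hu0 : u ≠ 0) (hw0 : w ≠ 0)
    (hu : toEuclideanLin (borderedMat A v ε δ) u = (l : ℂ) • u)
    (hw : toEuclideanLin (borderedMat A v 0 δ) w = (k : ℂ) • w)
    (hl : K * |l| ≤ 1 / 2) (hk : K * |k| ≤ 1 / 2) :
    |l - k - ε| ≤ |l - k| * (4 * K ^ 2 * δ ^ 2) := by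
  have hxu := norm_topPart_le hv hK hA hl hu
  have hxw := norm_topPart_le hv hK hA hk hw
  have pos : ∀ z : EuclideanSpace ℂ (Fin m ⊕ Fin 1), z ≠ 0 →
      ‖topPart z‖ ≤ 2 * K * |δ| * ‖z (Sum.inr 0)‖ → 0 < ‖z (Sum.inr 0)‖ := by
    intro z hz h
    by_contra hc
    have h1 : ‖z (Sum.inr 0)‖ = 0 := le_antisymm (not_lt.1 hc) (norm_nonneg _)
    have h2 : ‖topPart z‖ = 0 := le_antisymm (by simpa [h1] using h) (norm_nonneg _)
    have h3 := norm_sq_eq_topPart_add z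
    rw [h1, h2] at h3
    exact hz (by simpa using h3)
  have hyu := pos u hu0 hxu
  have hyw := pos w hw0 hxw
  have key := sub_mul_inner_eigenvectors h0 hu hw
  rw [inner_eq_inner_topPart_add] at key
  have key' : ((l - k - ε : ℝ) : ℂ) * (u (Sum.inr 0) * star (w (Sum.inr 0)))
      = -((l - k : ℝ) : ℂ) * inner ℂ (topPart w) (topPart u) := by
    push_cast
    linear_combination key
  have hn := congrArg norm key'
  simp only [norm_mul, norm_neg, norm_star, Complex.norm_real, Real.norm_eq_abs] at hn
  have h1 : ‖inner ℂ (topPart w) (topPart u)‖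
      ≤ (4 * K ^ 2 * δ ^ 2) * (‖u (Sum.inr 0)‖ * ‖w (Sum.inr 0)‖) := by
    refine (norm_inner_le_norm _ _).trans ((mul_le_mul hxw hxu (norm_nonneg _)
      (by positivity)).trans (le_of_eq ?_))
    rw [← sq_abs δ]
    ring
  refine le_of_mul_le_mul_right ?_ (mul_pos hyu hyw)
  rw [hn, mul_assoc]
  exact mul_le_mul_of_nonneg_left h1 (abs_nonneg _)

theorem exists_norm_le_mul_norm_toEuclideanLin (hA : IsUnit A) :
    ∃ K : ℝ, 1 ≤ K ∧ ∀ x, ‖x‖ ≤ K * ‖toEuclideanLin A x‖ := by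
  refine ⟨‖toEuclideanCLM (𝕜 := ℂ) A⁻¹‖ + 1, by simp, fun x => ?_⟩
  have h1 : toEuclideanCLM (𝕜 := ℂ) A⁻¹ (toEuclideanLin A x) = x := by
    change toEuclideanCLM (𝕜 := ℂ) A⁻¹ (toEuclideanCLM (𝕜 := ℂ) A x) = x
    rw [← mul_apply_eq_comp, ← map_mul,
      Matrix.nonsing_inv_mul _ ((Matrix.isUnit_iff_isUnit_det A).1 hA), map_one]
    rfl
  have h2 := (toEuclideanCLM (𝕜 := ℂ) A⁻¹).le_opNorm (toEuclideanLin A x)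
  rw [h1] at h2
  linarith [norm_nonneg (toEuclideanLin A x)]

theorem borderedMat_zero_det : (borderedMat A v 0 0).det = 0 :=
  Matrix.det_eq_zero_of_row_eq_zero (Sum.inr 0) fun j => by
    rcases j with j | j <;> simp [borderedMat]

theorem borderedMat_trace : (borderedMat A v ε δ).trace = A.trace + ε := by
  simp [borderedMat, Matrix.trace, Fintype.sum_sum_type]

end Bordered

/-- Real numbers of a common sign are bounded in absolute value by their total minus any
other one of them. -/
theorem abs_le_abs_sum_sub {ι : Type*} [Fintype ι] [DecidableEq ι] {d : ι → ℝ}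
    (hd : (∀ i, 0 ≤ d i) ∨ ∀ i, d i ≤ 0) {i j : ι} (hij : i ≠ j) :
    |d i| ≤ |∑ k, d k - d j| := by
  rw [← Finset.sum_erase_eq_sub (Finset.mem_univ j)]
  have hi : i ∈ Finset.univ.erase j := by simp [hij]
  rcases hd with hd | hd
  · have := Finset.single_le_sum (f := d) (fun k _ => hd k) hi
    rw [abs_of_nonneg (hd i)]
    exact this.trans (le_abs_self _)
  · have := Finset.single_le_sum (f := fun k => - d k) (fun k _ => neg_nonneg.2 (hd k)) hi
    rw [abs_of_nonpos (hd i)]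
    rw [Finset.sum_neg_distrib] at this
    exact this.trans (neg_le_abs _)

/-- For a nonsingular Hermitian `A11`, perturbing the corner entry `0 ↦ ε` of
the bordered matrix moves all but one eigenvalue by `O(ε δ²)`, and the
remaining eigenvalue by at most `|ε|`. -/
theorem stmt_10 {m : ℕ} (A11 : Matrix (Fin m) (Fin m) ℂ)
    (hA11 : A11.IsHermitian) (hinv : IsUnit A11)
    (v : Fin m → ℂ) (hv : euclNorm v = 1)
    (hM : ∀ ε δ : ℝ, (borderedMat A11 v ε δ).IsHermitian) :
    ∃ C > 0, ∀ ε δ : ℝ, |ε| ≤ 1 / C → |δ| ≤ 1 / C →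
      ∃ jbad : Fin (Fintype.card (Fin m ⊕ Fin 1)),
        (∀ i, i ≠ jbad →
          |ithEig (hM ε δ) i - ithEig (hM 0 δ) i| ≤ C * |ε| * δ ^ 2) ∧
        |ithEig (hM ε δ) jbad - ithEig (hM 0 δ) jbad| ≤ |ε| := by
  have hv' : ‖WithLp.toLp 2 v‖ = 1 := by
    rw [EuclideanSpace.norm_eq]
    exact hv
  obtain ⟨K, hK1, hK⟩ := exists_norm_le_mul_norm_toEuclideanLin hinv
  have hK0 : 0 ≤ K := zero_le_one.trans hK1
  refine ⟨4 * K ^ 2 + 4 * K, by positivity, fun ε δ hε hδ => ?_⟩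
  obtain ⟨k, hk⟩ := exists_ithEig_eq_zero (hM 0 0) borderedMat_zero_det
  have corner : ∀ x : EuclideanSpace ℂ (Fin m ⊕ Fin 1), ‖x (Sum.inr 0)‖ ^ 2 ≤ ‖x‖ ^ 2 := fun x => by
    rw [norm_sq_eq_topPart_add x]
    linarith [sq_nonneg ‖topPart x‖]
  have upper : ∀ i, ithEig (hM ε δ) i ≤ ithEig (hM 0 δ) i + max ε 0 :=
    ithEig_le_add _ _ _ fun x => by
      simp only [re_inner_borderedMat]
      nlinarith [mul_le_mul_of_nonneg_right (le_max_left ε 0) (sq_nonneg ‖x (Sum.inr 0)‖),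
        mul_le_mul_of_nonneg_left (corner x) (le_max_right ε 0)]
  have lower : ∀ i, ithEig (hM 0 δ) i ≤ ithEig (hM ε δ) i + max (-ε) 0 :=
    ithEig_le_add _ _ _ fun x => by
      simp only [re_inner_borderedMat]
      nlinarith [mul_le_mul_of_nonneg_right (le_max_left (-ε) 0) (sq_nonneg ‖x (Sum.inr 0)‖),
        mul_le_mul_of_nonneg_left (corner x) (le_max_right (-ε) 0)]
  have sign : (∀ i, 0 ≤ ithEig (hM ε δ) i - ithEig (hM 0 δ) i) ∨
      ∀ i, ithEig (hM ε δ) i - ithEig (hM 0 δ) i ≤ 0 := by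
    rcases le_total 0 ε with h | h
    · left
      intro i
      have := lower i
      rw [max_eq_right (by linarith)] at this
      linarith
    · right
      intro i
      have := upper i
      rw [max_eq_right h] at this
      linarith
  have weyl : ∀ i, |ithEig (hM ε δ) i - ithEig (hM 0 δ) i| ≤ |ε| := fun i => by
    have h1 : max ε 0 ≤ |ε| := max_le (le_abs_self _) (abs_nonneg _)
    have h2 : max (-ε) 0 ≤ |ε| := max_le (neg_le_abs _) (abs_nonneg _)
    rw [abs_le]
    constructor <;> linarith [upper i, lower i]
  have total : ∑ i, (ithEig (hM ε δ) i - ithEig (hM 0 δ) i) = ε := by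
    rw [Finset.sum_sub_distrib, sum_ithEig, sum_ithEig, borderedMat_trace, borderedMat_trace]
    simp
  have small0 : |ithEig (hM 0 δ) k| ≤ |δ| := by
    have bound := fun x : EuclideanSpace ℂ (Fin m ⊕ Fin 1) =>
      abs_le.1 ((abs_mul δ _).trans_le
        (mul_le_mul_of_nonneg_left (abs_re_cross_le x hv') (abs_nonneg δ)))
    have h1 := ithEig_le_add (hM 0 δ) (hM 0 0) |δ| (fun x => by
      simp only [re_inner_borderedMat]
      linarith [(bound x).2]) k
    have h2 := ithEig_le_add (hM 0 0) (hM 0 δ) |δ| (fun x => by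
      simp only [re_inner_borderedMat]
      linarith [(bound x).1]) k
    rw [abs_le]
    constructor <;> linarith
  have small1 : |ithEig (hM ε δ) k| ≤ |ε| + |δ| := by
    have := abs_add_le (ithEig (hM ε δ) k - ithEig (hM 0 δ) k) (ithEig (hM 0 δ) k)
    rw [sub_add_cancel] at this
    linarith [weyl k]
  have hC : 1 / (4 * K ^ 2 + 4 * K) ≤ 1 / (4 * K) :=
    one_div_le_one_div_of_le (by linarith) (by nlinarith)
  have hCK : K * (1 / (4 * K)) = 1 / 4 := by field_simp
  have hεK := mul_le_mul_of_nonneg_left (hε.trans hC) hK0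
  have hδK := mul_le_mul_of_nonneg_left (hδ.trans hC) hK0
  have main := abs_eigenvalue_sub_sub_le hv' hK0 hK (hM 0 δ)
    ((sortedEigenbasis (hM ε δ)).orthonormal.ne_zero k)
    ((sortedEigenbasis (hM 0 δ)).orthonormal.ne_zero k)
    (toEuclideanLin_sortedEigenbasis (hM ε δ) k) (toEuclideanLin_sortedEigenbasis (hM 0 δ) k)
    (by linarith [mul_le_mul_of_nonneg_left small1 hK0])
    (by linarith [mul_le_mul_of_nonneg_left small0 hK0])
  refine ⟨k, fun i hi => ?_, weyl k⟩
  have h1 := abs_le_abs_sum_sub sign hi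
  rw [total, abs_sub_comm ε] at h1
  have h2 := mul_le_mul_of_nonneg_right (weyl k) (by positivity : 0 ≤ 4 * K ^ 2 * δ ^ 2)
  have h3 : 0 ≤ 4 * K * |ε| * δ ^ 2 := by positivity
  linarith
end

section
/- Let A be an n×n Hermitian matrix with an eigenvalue λ₀ of multiplicity r, and let Q = (Q₁, Q₂) be unitary with Q^H A Q = diag(λ₀ I_r, Λ), where Λ is diagonal with no diagonal entry equal to λ₀. Let E be Hermitian. Then the r eigenvalues λ̂_1,…,λ̂_r of A + εE that converge to λ₀ as ε → 0 admit the expansion λ̂_i = λ₀ + μ_i(Q₁^H E Q₁) ε + O(ε²), where μ_i denotes the i-th eigenvalue of the r×r Hermitian matrix Q₁^H E Q₁. In particular, the trailing term is O(ε²) rather than merely o(ε). -/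
open Matrix

theorem lt_card_filter_le_sort {n : ℕ} (f : Fin n → ℝ) (k : Fin n) :
    (k : ℕ) < (Finset.univ.filter fun i => f i ≤ f (Tuple.sort f k)).card := by
  have h : (Finset.Iic k).map (Tuple.sort f).toEmbedding ⊆
      Finset.univ.filter fun i => f i ≤ f (Tuple.sort f k) := by
    intro i hi
    obtain ⟨j, hj, rfl⟩ := Finset.mem_map.1 hi
    simpa using Tuple.monotone_sort f (Finset.mem_Iic.1 hj)
  have := Finset.card_le_card h
  rw [Finset.card_map, Fin.card_Iic] at this
  omega

theorem le_card_filter_sort_le_add {n : ℕ} (f : Fin n → ℝ) (k : Fin n) :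
    n ≤ (Finset.univ.filter fun i => f (Tuple.sort f k) ≤ f i).card + k := by
  have h : (Finset.Ici k).map (Tuple.sort f).toEmbedding ⊆
      Finset.univ.filter fun i => f (Tuple.sort f k) ≤ f i := by
    intro i hi
    obtain ⟨j, hj, rfl⟩ := Finset.mem_map.1 hi
    simpa using Tuple.monotone_sort f (Finset.mem_Ici.1 hj)
  have := Finset.card_le_card h
  rw [Finset.card_map, Fin.card_Ici] at this
  omega

theorem card_filter_comp_equiv {I J : Type*} [Fintype I] [Fintype J] (e : J ≃ I)
    (p : I → Prop) [DecidablePred p] :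
    (Finset.univ.filter fun j => p (e j)).card = (Finset.univ.filter p).card := by
  rw [← Fintype.card_subtype, ← Fintype.card_subtype]
  exact Fintype.card_congr (e.subtypeEquiv fun _ => Iff.rfl)

theorem star_dotProduct_self_re {I : Type*} [Fintype I] (x : I → ℂ) :
    (star x ⬝ᵥ x).re = ∑ i, ‖x i‖ ^ 2 := by
  simp [dotProduct, Complex.sq_norm, Complex.normSq_apply]

section ithEig

variable {I : Type*} [Fintype I] [DecidableEq I] {M : Matrix I I ℂ}

theorem lt_card_filter_eigenvalues_le_ithEig (hM : M.IsHermitian) (k : Fin (Fintype.card I)) :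
    (k : ℕ) < (Finset.univ.filter fun i => hM.eigenvalues i ≤ ithEig hM k).card := by
  rw [← card_filter_comp_equiv (Fintype.equivFin I).symm]
  exact lt_card_filter_le_sort _ k

theorem card_le_card_filter_ithEig_le_eigenvalues_add (hM : M.IsHermitian)
    (k : Fin (Fintype.card I)) :
    Fintype.card I ≤ (Finset.univ.filter fun i => ithEig hM k ≤ hM.eigenvalues i).card + k := by
  rw [← card_filter_comp_equiv (Fintype.equivFin I).symm]
  exact le_card_filter_sort_le_add _ k

theorem exists_ithEig_eq_eigenvalues (hM : M.IsHermitian) (k : Fin (Fintype.card I)) :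
    ∃ i, ithEig hM k = hM.eigenvalues i :=
  ⟨_, rfl⟩

theorem Matrix.IsHermitian.exists_unitary_diagonal (hM : M.IsHermitian) :
    ∃ U : Matrix I I ℂ, Uᴴ * U = 1 ∧
      Uᴴ * M * U = Matrix.diagonal fun i => (hM.eigenvalues i : ℂ) := by
  refine ⟨hM.eigenvectorUnitary, ?_, ?_⟩
  · exact (Matrix.mem_unitaryGroup_iff'.1 hM.eigenvectorUnitary.2)
  · have h := hM.conjStarAlgAut_star_eigenvectorUnitary
    rw [Unitary.conjStarAlgAut_apply] at h
    simpa [Matrix.star_eq_conjTranspose, Function.comp_def] using h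

theorem star_dotProduct_conj_mulVec {U : Matrix I I ℂ} (hU : Uᴴ * U = 1) (x : I → ℂ) :
    star (Uᴴ *ᵥ x) ⬝ᵥ (Uᴴ * M * U) *ᵥ (Uᴴ *ᵥ x) = star x ⬝ᵥ M *ᵥ x := by
  have hU' := mul_eq_one_comm.1 hU
  rw [Matrix.star_mulVec, ← Matrix.dotProduct_mulVec, Matrix.conjTranspose_conjTranspose,
    Matrix.mulVec_mulVec, Matrix.mulVec_mulVec]
  congr 2
  calc U * (Uᴴ * M * U) * Uᴴ = (U * Uᴴ) * M * (U * Uᴴ) := by simp only [Matrix.mul_assoc]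
    _ = M := by simp [hU']

theorem sum_norm_sq_conj_mulVec {U : Matrix I I ℂ} (hU : Uᴴ * U = 1) (x : I → ℂ) :
    ∑ i, ‖(Uᴴ *ᵥ x) i‖ ^ 2 = ∑ i, ‖x i‖ ^ 2 := by
  have h := star_dotProduct_conj_mulVec (M := 1) hU x
  simp only [Matrix.mul_one, hU, Matrix.one_mulVec] at h
  rw [← star_dotProduct_self_re, ← star_dotProduct_self_re, h]

theorem star_dotProduct_diagonal_mulVec_re (e : I → ℝ) (x : I → ℂ) :
    (star x ⬝ᵥ (Matrix.diagonal fun i => (e i : ℂ)) *ᵥ x).re = ∑ i, e i * ‖x i‖ ^ 2 := by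
  simp only [dotProduct, Matrix.mulVec_diagonal, Complex.re_sum]
  refine Finset.sum_congr rfl fun i _ => ?_
  simp [Complex.sq_norm, Complex.normSq_apply]
  ring

theorem card_add_card_le_of_form_le {U P : Matrix I I ℂ} (hU : Uᴴ * U = 1) (hP : Pᴴ * P = 1)
    {e : I → ℝ} (he : Uᴴ * M * U = Matrix.diagonal fun i => (e i : ℂ)) {c : ℝ} {S J : Finset I}
    (hS : ∀ z : I → ℂ, (∀ i, i ∉ S → z i = 0) →
      (star z ⬝ᵥ (Pᴴ * M * P) *ᵥ z).re ≤ c * ∑ i, ‖z i‖ ^ 2)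
    (hJ : ∀ i ∈ J, c < e i) : S.card + J.card ≤ Fintype.card I := by
  by_contra! hlt
  let T : (I → ℂ) →ₗ[ℂ] (({i // i ∉ S} → ℂ) × ({i // i ∉ J} → ℂ)) :=
    ((LinearMap.funLeft ℂ ℂ Subtype.val).comp Pᴴ.mulVecLin).prod
      ((LinearMap.funLeft ℂ ℂ Subtype.val).comp Uᴴ.mulVecLin)
  have hT : LinearMap.ker T ≠ ⊥ := by
    apply LinearMap.ker_ne_bot_of_finrank_lt
    rw [Module.finrank_prod]
    simp only [Module.finrank_fintype_fun_eq_card, Fintype.card_subtype_compl,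
      Fintype.card_coe]
    have := S.card_le_univ
    have := J.card_le_univ
    omega
  obtain ⟨x, hx, hx0⟩ := (Submodule.ne_bot_iff _).1 hT
  have hx' := Prod.ext_iff.1 (LinearMap.mem_ker.1 hx)
  have hxS : ∀ i, i ∉ S → (Pᴴ *ᵥ x) i = 0 := fun i hi => congrFun hx'.1 ⟨i, hi⟩
  have hxJ : ∀ i, i ∉ J → (Uᴴ *ᵥ x) i = 0 := fun i hi => congrFun hx'.2 ⟨i, hi⟩
  have h1 := hS _ hxS
  rw [star_dotProduct_conj_mulVec hP, sum_norm_sq_conj_mulVec hP,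
    ← star_dotProduct_conj_mulVec hU, he, star_dotProduct_diagonal_mulVec_re,
    ← sum_norm_sq_conj_mulVec hU, Finset.mul_sum] at h1
  have hle : ∀ i ∈ Finset.univ, c * ‖(Uᴴ *ᵥ x) i‖ ^ 2 ≤ e i * ‖(Uᴴ *ᵥ x) i‖ ^ 2 := by
    intro i _
    by_cases hi : i ∈ J
    · exact mul_le_mul_of_nonneg_right (hJ i hi).le (by positivity)
    · simp [hxJ i hi]
  have heq := (Finset.sum_eq_sum_iff_of_le hle).1 (le_antisymm (Finset.sum_le_sum hle) h1)
  have hy : Uᴴ *ᵥ x = 0 := by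
    funext i
    by_cases hi : i ∈ J
    · have h2 := heq i (Finset.mem_univ i)
      by_contra hne
      have : 0 < ‖(Uᴴ *ᵥ x) i‖ ^ 2 := by
        have := norm_pos_iff.2 hne
        positivity
      nlinarith [hJ i hi]
    · exact hxJ i hi
  apply hx0
  rw [← Matrix.one_mulVec x, ← mul_eq_one_comm.1 hU, ← Matrix.mulVec_mulVec, hy,
    Matrix.mulVec_zero]

theorem ithEig_le_of_form_le (hM : M.IsHermitian) {P : Matrix I I ℂ} (hP : Pᴴ * P = 1)
    {c : ℝ} {S : Finset I}
    (hS : ∀ z : I → ℂ, (∀ i, i ∉ S → z i = 0) →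
      (star z ⬝ᵥ (Pᴴ * M * P) *ᵥ z).re ≤ c * ∑ i, ‖z i‖ ^ 2)
    (k : Fin (Fintype.card I)) (hk : (k : ℕ) < S.card) : ithEig hM k ≤ c := by
  obtain ⟨U, hU, he⟩ := hM.exists_unitary_diagonal
  by_contra! hc
  have h := card_add_card_le_of_form_le hU hP he hS
    (J := Finset.univ.filter fun i => ithEig hM k ≤ hM.eigenvalues i)
    fun i hi => hc.trans_le (Finset.mem_filter.1 hi).2
  have := card_le_card_filter_ithEig_le_eigenvalues_add hM k
  omega

theorem le_ithEig_of_form_neg_le (hM : M.IsHermitian) {P : Matrix I I ℂ} (hP : Pᴴ * P = 1)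
    {c : ℝ} {S : Finset I}
    (hS : ∀ z : I → ℂ, (∀ i, i ∉ S → z i = 0) →
      (star z ⬝ᵥ (Pᴴ * (-M) * P) *ᵥ z).re ≤ -c * ∑ i, ‖z i‖ ^ 2)
    (k : Fin (Fintype.card I)) (hk : Fintype.card I ≤ S.card + k) : c ≤ ithEig hM k := by
  obtain ⟨U, hU, he⟩ := hM.exists_unitary_diagonal
  have he' : Uᴴ * (-M) * U = Matrix.diagonal fun i => ((-hM.eigenvalues i : ℝ) : ℂ) := by
    rw [Matrix.mul_neg, Matrix.neg_mul, he, Matrix.diagonal_neg]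
    simp
  by_contra! hc
  have h := card_add_card_le_of_form_le hU hP he' hS
    (J := Finset.univ.filter fun i => hM.eigenvalues i ≤ ithEig hM k)
    fun i hi => by
      have := (Finset.mem_filter.1 hi).2
      linarith
  have := lt_card_filter_eigenvalues_le_ithEig hM k
  omega

end ithEig

section Perturbation

variable {r s : ℕ}

theorem abs_form_le_of_block_eq_zero {G : Matrix (Fin r ⊕ Fin s) (Fin r ⊕ Fin s) ℂ}
    (hG : ∀ i j, G (Sum.inl i) (Sum.inl j) = 0) (z : Fin r ⊕ Fin s → ℂ) {a b : ℝ}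
    (ha : 0 ≤ a) (hb : 0 ≤ b) (hza : ∑ i, ‖z (Sum.inl i)‖ ^ 2 = a ^ 2)
    (hzb : ∑ j, ‖z (Sum.inr j)‖ ^ 2 = b ^ 2) :
    |(star z ⬝ᵥ G *ᵥ z).re| ≤ (∑ p, ∑ q, ‖G p q‖) * (2 * (a * b) + b ^ 2) := by
  have hl : ∀ i, ‖z (Sum.inl i)‖ ≤ a := fun i => by
    refine abs_le_of_sq_le_sq' ?_ ha |>.2
    rw [← hza]
    exact Finset.single_le_sum (f := fun i => ‖z (Sum.inl i)‖ ^ 2)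
      (fun _ _ => by positivity) (Finset.mem_univ i)
  have hr : ∀ j, ‖z (Sum.inr j)‖ ≤ b := fun j => by
    refine abs_le_of_sq_le_sq' ?_ hb |>.2
    rw [← hzb]
    exact Finset.single_le_sum (f := fun i => ‖z (Sum.inr i)‖ ^ 2)
      (fun _ _ => by positivity) (Finset.mem_univ j)
  have hab : 0 ≤ a * b := mul_nonneg ha hb
  have hterm : ∀ p q, ‖star (z p) * (G p q * z q)‖ ≤ ‖G p q‖ * (2 * (a * b) + b ^ 2) := by
    intro p q
    have hnorm : ‖star (z p) * (G p q * z q)‖ = ‖G p q‖ * (‖z p‖ * ‖z q‖) := by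
      rw [norm_mul, norm_mul, norm_star]
      ring
    rw [hnorm]
    rcases p with i | i <;> rcases q with j | j
    · simp [hG]
    · refine mul_le_mul_of_nonneg_left ?_ (norm_nonneg _)
      nlinarith [mul_le_mul (hl i) (hr j) (norm_nonneg _) ha, sq_nonneg b]
    · refine mul_le_mul_of_nonneg_left ?_ (norm_nonneg _)
      nlinarith [mul_le_mul (hr i) (hl j) (norm_nonneg _) hb, sq_nonneg b]
    · refine mul_le_mul_of_nonneg_left ?_ (norm_nonneg _)
      nlinarith [mul_le_mul (hr i) (hr j) (norm_nonneg _) hb]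
  calc |(star z ⬝ᵥ G *ᵥ z).re| ≤ ‖star z ⬝ᵥ G *ᵥ z‖ := Complex.abs_re_le_norm _
    _ = ‖∑ p, ∑ q, star (z p) * (G p q * z q)‖ := by
      simp only [dotProduct, Matrix.mulVec, Finset.mul_sum, Pi.star_apply]
    _ ≤ ∑ p, ∑ q, ‖star (z p) * (G p q * z q)‖ :=
      (norm_sum_le _ _).trans (Finset.sum_le_sum fun _ _ => norm_sum_le _ _)
    _ ≤ ∑ p, ∑ q, ‖G p q‖ * (2 * (a * b) + b ^ 2) :=
      Finset.sum_le_sum fun p _ => Finset.sum_le_sum fun q _ => hterm p q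
    _ = _ := by simp only [Finset.sum_mul]

theorem quadratic_residual_bound {a b K g C ε μ : ℝ} (hg : 0 < g) (hC : 0 < C)
    (hKg : 4 * K ≤ C * g) (hKg' : 2 * K ^ 2 ≤ C * g) (hμ : |μ| ≤ K) (hε : |ε| ≤ 1 / C) :
    |ε| * (K * (2 * (a * b) + b ^ 2)) ≤ C * ε ^ 2 * (a ^ 2 + b ^ 2) + (g + ε * μ) * b ^ 2 := by
  have hεC : |ε| * C ≤ 1 := (le_div_iff₀ hC).1 hε
  have h1 : |ε| * (4 * K) ≤ g := by
    nlinarith [mul_le_mul_of_nonneg_left hKg (abs_nonneg ε)]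
  have h2 : -(|ε| * K) ≤ ε * μ := by
    have := neg_abs_le (ε * μ)
    rw [abs_mul] at this
    nlinarith [mul_le_mul_of_nonneg_left hμ (abs_nonneg ε)]
  have h3 : 2 * (|ε| * K) ^ 2 ≤ C * ε ^ 2 * g := by
    rw [mul_pow, sq_abs]
    nlinarith [mul_le_mul_of_nonneg_left hKg' (sq_nonneg ε)]
  have h4 : 2 * (|ε| * K) * (a * b) ≤ C * ε ^ 2 * a ^ 2 + g / 2 * b ^ 2 := by
    refine le_of_mul_le_mul_left ?_ hg
    nlinarith [sq_nonneg (2 * (|ε| * K) * a - g * b),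
      mul_le_mul_of_nonneg_right h3 (sq_nonneg a)]
  have h5 : 0 ≤ C * ε ^ 2 * b ^ 2 := by positivity
  nlinarith [mul_le_mul_of_nonneg_right h1 (sq_nonneg b),
    mul_le_mul_of_nonneg_right h2 (sq_nonneg b)]

theorem form_le_of_support {G : Matrix (Fin r ⊕ Fin s) (Fin r ⊕ Fin s) ℂ}
    (hG : ∀ i j, G (Sum.inl i) (Sum.inl j) = 0) {K g C ε μ lam0 : ℝ} (hg : 0 < g) (hC : 0 < C)
    (hK : ∑ p, ∑ q, ‖G p q‖ ≤ K)
    (hKg : 4 * K ≤ C * g) (hKg' : 2 * K ^ 2 ≤ C * g) (hμ : |μ| ≤ K) (hε : |ε| ≤ 1 / C)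
    {ν : Fin r → ℝ} {d : Fin s → ℝ} (hd : ∀ j, g ≤ |d j - lam0|) (z : Fin r ⊕ Fin s → ℂ)
    (hzl : ∀ i, z (Sum.inl i) ≠ 0 → ε * ν i ≤ ε * μ)
    (hzr : ∀ j, z (Sum.inr j) ≠ 0 → d j < lam0) :
    (star z ⬝ᵥ ((Matrix.diagonal fun p => ((Sum.elim (fun i => lam0 + ε * ν i) d p : ℝ) : ℂ)) +
      (ε : ℂ) • G) *ᵥ z).re ≤ (lam0 + ε * μ + C * ε ^ 2) * ∑ p, ‖z p‖ ^ 2 := by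
  set a := √(∑ i, ‖z (Sum.inl i)‖ ^ 2)
  set b := √(∑ j, ‖z (Sum.inr j)‖ ^ 2)
  have ha : 0 ≤ a := Real.sqrt_nonneg _
  have hb : 0 ≤ b := Real.sqrt_nonneg _
  have hza : ∑ i, ‖z (Sum.inl i)‖ ^ 2 = a ^ 2 :=
    (Real.sq_sqrt (Finset.sum_nonneg fun _ _ => by positivity)).symm
  have hzb : ∑ j, ‖z (Sum.inr j)‖ ^ 2 = b ^ 2 :=
    (Real.sq_sqrt (Finset.sum_nonneg fun _ _ => by positivity)).symm
  have hG1 : ε * (star z ⬝ᵥ G *ᵥ z).re ≤ |ε| * (K * (2 * (a * b) + b ^ 2)) := by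
    refine (le_abs_self _).trans ?_
    rw [abs_mul]
    refine mul_le_mul_of_nonneg_left ?_ (abs_nonneg ε)
    refine (abs_form_le_of_block_eq_zero hG z ha hb hza hzb).trans ?_
    exact mul_le_mul_of_nonneg_right hK (by positivity)
  have hG2 := quadratic_residual_bound (a := a) (b := b) hg hC hKg hKg' hμ hε
  have hl : ∑ i, (lam0 + ε * ν i) * ‖z (Sum.inl i)‖ ^ 2 ≤ (lam0 + ε * μ) * a ^ 2 := by
    rw [← hza, Finset.mul_sum]
    refine Finset.sum_le_sum fun i _ => ?_
    by_cases hi : z (Sum.inl i) = 0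
    · simp [hi]
    · exact mul_le_mul_of_nonneg_right (by linarith [hzl i hi]) (by positivity)
  have hr : ∑ j, d j * ‖z (Sum.inr j)‖ ^ 2 ≤ (lam0 - g) * b ^ 2 := by
    rw [← hzb, Finset.mul_sum]
    refine Finset.sum_le_sum fun j _ => ?_
    by_cases hj : z (Sum.inr j) = 0
    · simp [hj]
    · have h1 := hzr j hj
      have h2 := hd j
      rw [abs_of_neg (by linarith)] at h2
      exact mul_le_mul_of_nonneg_right (by linarith) (by positivity)
  rw [Matrix.add_mulVec, dotProduct_add, Complex.add_re, star_dotProduct_diagonal_mulVec_re,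
    Matrix.smul_mulVec, dotProduct_smul, smul_eq_mul, Complex.re_ofReal_mul,
    Fintype.sum_sum_type, Fintype.sum_sum_type, hza, hzb]
  simp only [Sum.elim_inl, Sum.elim_inr]
  linarith

theorem abs_ithEig_sub_le_s16 {M P G : Matrix (Fin r ⊕ Fin s) (Fin r ⊕ Fin s) ℂ}
    (hM : M.IsHermitian) (hP : Pᴴ * P = 1) {K g C ε μ lam0 : ℝ} {ν : Fin r → ℝ} {d : Fin s → ℝ}
    (hPMP : Pᴴ * M * P =
      (Matrix.diagonal fun p => ((Sum.elim (fun i => lam0 + ε * ν i) d p : ℝ) : ℂ)) +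
        (ε : ℂ) • G)
    (hG : ∀ i j, G (Sum.inl i) (Sum.inl j) = 0) (hg : 0 < g) (hC : 0 < C)
    (hK : ∑ p, ∑ q, ‖G p q‖ ≤ K)
    (hKg : 4 * K ≤ C * g) (hKg' : 2 * K ^ 2 ≤ C * g) (hμ : |μ| ≤ K) (hε : |ε| ≤ 1 / C)
    (hd : ∀ j, g ≤ |d j - lam0|) (k : Fin (Fintype.card (Fin r ⊕ Fin s)))
    (hupper : (k : ℕ) < (Finset.univ.filter fun i => ε * ν i ≤ ε * μ).card +
      (Finset.univ.filter fun j => d j < lam0).card)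
    (hlower : r + s ≤ (Finset.univ.filter fun i => ε * μ ≤ ε * ν i).card +
      (Finset.univ.filter fun j => lam0 < d j).card + k) :
    |ithEig hM k - (lam0 + μ * ε)| ≤ C * ε ^ 2 := by
  have hup : ithEig hM k ≤ lam0 + ε * μ + C * ε ^ 2 := by
    refine ithEig_le_of_form_le hM hP (S := (Finset.univ.filter fun i => ε * ν i ≤ ε * μ).disjSum
      (Finset.univ.filter fun j => d j < lam0)) (fun z hz => ?_) k
      (by rwa [Finset.card_disjSum])
    rw [hPMP]
    refine form_le_of_support hG hg hC hK hKg hKg' hμ hε hd z (fun i hi => ?_) fun j hj => ?_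
    · by_contra hn
      exact hi (hz _ (by simpa using hn))
    · by_contra hn
      exact hj (hz _ (by simpa using hn))
  have hlow : lam0 + ε * μ - C * ε ^ 2 ≤ ithEig hM k := by
    refine le_ithEig_of_form_neg_le hM hP
      (S := (Finset.univ.filter fun i => ε * μ ≤ ε * ν i).disjSum
      (Finset.univ.filter fun j => lam0 < d j)) (fun z hz => ?_) k
      (by simpa [Finset.card_disjSum] using hlower)
    have hneg : Pᴴ * (-M) * P = (Matrix.diagonal fun p =>
        ((Sum.elim (fun i => -lam0 + -ε * ν i) (fun j => -d j) p : ℝ) : ℂ)) +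
        ((-ε : ℝ) : ℂ) • G := by
      rw [Matrix.mul_neg, Matrix.neg_mul, hPMP, neg_add, Matrix.diagonal_neg, Complex.ofReal_neg,
        neg_smul]
      congr 2
      funext p
      rcases p with i | j
      · simp
        ring
      · simp
    have h := form_le_of_support (ε := -ε) (lam0 := -lam0) (d := fun j => -d j) (ν := ν)
      hG hg hC hK hKg hKg' hμ (by rwa [abs_neg])
      (fun j => by rw [← abs_neg]; convert hd j using 2; ring) z
      (fun i hi => ?_) fun j hj => ?_
    · rw [hneg]
      convert h using 2
      ring
    · by_contra hn
      exact hi (hz _ (by simpa using hn))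
    · by_contra hn
      exact hj (hz _ (by simpa using hn))
  rw [abs_le]
  constructor <;> linarith

theorem exists_unitary_refinement {A E Q : Matrix (Fin r ⊕ Fin s) (Fin r ⊕ Fin s) ℂ}
    {lam0 : ℝ} {d : Fin s → ℝ} (hQ : Qᴴ * Q = 1)
    (hQAQ : Qᴴ * A * Q =
      fromBlocks ((lam0 : ℂ) • (1 : Matrix (Fin r) (Fin r) ℂ)) 0 0
        (Matrix.diagonal fun j => ((d j : ℝ) : ℂ)))
    (hE₁ : ((Q.submatrix id Sum.inl)ᴴ * E * Q.submatrix id Sum.inl).IsHermitian) :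
    ∃ P G : Matrix (Fin r ⊕ Fin s) (Fin r ⊕ Fin s) ℂ, Pᴴ * P = 1 ∧
      (∀ i j, G (Sum.inl i) (Sum.inl j) = 0) ∧ ∀ ε : ℝ, Pᴴ * (A + ε • E) * P =
        (Matrix.diagonal fun p =>
          ((Sum.elim (fun i => lam0 + ε * hE₁.eigenvalues i) d p : ℝ) : ℂ)) + (ε : ℂ) • G := by
  obtain ⟨V, hV, hVE⟩ := hE₁.exists_unitary_diagonal
  set W : Matrix (Fin r ⊕ Fin s) (Fin r ⊕ Fin s) ℂ := fromBlocks V 0 0 1 with hW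
  have hWH : Wᴴ = fromBlocks Vᴴ 0 0 1 := by simp [hW, Matrix.fromBlocks_conjTranspose]
  have hconj : ∀ X, (Q * W)ᴴ * X * (Q * W) = Wᴴ * (Qᴴ * X * Q) * W := fun X => by
    simp only [Matrix.conjTranspose_mul, Matrix.mul_assoc]
  have hA : (Q * W)ᴴ * A * (Q * W) =
      Matrix.diagonal fun p => ((Sum.elim (fun _ => lam0) d p : ℝ) : ℂ) := by
    rw [hconj, hQAQ, hWH, hW, Matrix.fromBlocks_multiply, Matrix.fromBlocks_multiply]
    simp only [Matrix.mul_smul, Matrix.smul_mul, Matrix.mul_one, hV, Matrix.mul_zero,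
      Matrix.zero_mul, add_zero, zero_add, Matrix.one_mul, smul_zero]
    rw [Matrix.smul_one_eq_diagonal, Matrix.fromBlocks_diagonal]
    congr 1
    funext p
    rcases p with i | j <;> rfl
  have hE : ∀ i j, ((Q * W)ᴴ * E * (Q * W)) (Sum.inl i) (Sum.inl j) =
      Matrix.diagonal (fun i => (hE₁.eigenvalues i : ℂ)) i j := by
    intro i j
    have h11 : (Qᴴ * E * Q).toBlocks₁₁ =
      (Q.submatrix id Sum.inl)ᴴ * E * Q.submatrix id Sum.inl := rfl
    rw [hconj, ← Matrix.fromBlocks_toBlocks (Qᴴ * E * Q), hWH, hW, Matrix.fromBlocks_multiply,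
      Matrix.fromBlocks_multiply, Matrix.fromBlocks_apply₁₁, h11, ← hVE]
    simp
  refine ⟨Q * W, (Q * W)ᴴ * E * (Q * W) -
    Matrix.diagonal (Sum.elim (fun i => (hE₁.eigenvalues i : ℂ)) fun _ => 0), ?_, ?_, ?_⟩
  · have h := hconj 1
    simp only [Matrix.mul_one, hQ] at h
    rw [h, hWH, hW, Matrix.fromBlocks_multiply]
    simp [hV]
  · intro i j
    rw [Matrix.sub_apply, hE, sub_eq_zero]
    by_cases hij : i = j
    · simp [hij]
    · simp [hij]
  · intro ε
    have hdiag : (Matrix.diagonal fun p =>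
        ((Sum.elim (fun i => lam0 + ε * hE₁.eigenvalues i) d p : ℝ) : ℂ)) =
        (Matrix.diagonal fun p => ((Sum.elim (fun _ => lam0) d p : ℝ) : ℂ)) + (ε : ℂ) •
        Matrix.diagonal (Sum.elim (fun i => (hE₁.eigenvalues i : ℂ)) fun _ : Fin s => 0) := by
      rw [← Matrix.diagonal_smul, Matrix.diagonal_add]
      congr 1
      funext p
      rcases p with i | j <;> simp
    rw [hdiag, Matrix.mul_add, Matrix.add_mul, hA, smul_sub, Matrix.mul_smul, Matrix.smul_mul,
      add_assoc, add_sub_cancel, Complex.coe_smul]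

theorem exists_pos_le_abs_sub {d : Fin s → ℝ} {lam0 : ℝ} (hd : ∀ j, d j ≠ lam0) :
    ∃ g > 0, ∀ j, g ≤ |d j - lam0| := by
  rcases isEmpty_or_nonempty (Fin s) with h | h
  · exact ⟨1, one_pos, fun j => isEmptyElim j⟩
  · obtain ⟨j, hj⟩ := Finite.exists_min fun j => |d j - lam0|
    exact ⟨_, abs_pos.2 (sub_ne_zero.2 (hd j)), hj⟩

theorem card_filter_lt_add_card_filter_gt {d : Fin s → ℝ} {lam0 : ℝ} (hd : ∀ j, d j ≠ lam0) :
    (Finset.univ.filter fun j => d j < lam0).card +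
      (Finset.univ.filter fun j => lam0 < d j).card = s := by
  have h : (Finset.univ.filter fun j => lam0 < d j) =
      Finset.univ.filter fun j => ¬ d j < lam0 := by
    ext j
    simp [(hd j).symm.le_iff_lt]
  rw [h, Finset.card_filter_add_card_filter_not]
  simp

theorem exists_expansion_bound {A E Q : Matrix (Fin r ⊕ Fin s) (Fin r ⊕ Fin s) ℂ}
    (hAE : ∀ ε : ℝ, (A + ε • E).IsHermitian) {lam0 : ℝ} {d : Fin s → ℝ} (hd : ∀ j, d j ≠ lam0)
    (hQ : Qᴴ * Q = 1)
    (hQAQ : Qᴴ * A * Q =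
      fromBlocks ((lam0 : ℂ) • (1 : Matrix (Fin r) (Fin r) ℂ)) 0 0
        (Matrix.diagonal fun j => ((d j : ℝ) : ℂ)))
    (hE₁ : ((Q.submatrix id Sum.inl)ᴴ * E * Q.submatrix id Sum.inl).IsHermitian) :
    ∃ C > 0, ∀ ε : ℝ, |ε| ≤ 1 / C → ∀ (l : Fin (Fintype.card (Fin r)))
      (k : Fin (Fintype.card (Fin r ⊕ Fin s))),
      (0 ≤ ε ∧ (k : ℕ) = (Finset.univ.filter fun j => d j < lam0).card + l ∨
        ε ≤ 0 ∧ (k : ℕ) + l + 1 = (Finset.univ.filter fun j => d j < lam0).card + r) →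
      |ithEig (hAE ε) k - (lam0 + ithEig hE₁ l * ε)| ≤ C * ε ^ 2 := by
  obtain ⟨P, G, hP, hG, hPMP⟩ := exists_unitary_refinement hQ hQAQ hE₁
  obtain ⟨g, hg, hdg⟩ := exists_pos_le_abs_sub hd
  set K := (∑ p, ∑ q, ‖G p q‖) + ∑ i, |hE₁.eigenvalues i|
  have hG0 : 0 ≤ ∑ p, ∑ q, ‖G p q‖ :=
    Finset.sum_nonneg fun _ _ => Finset.sum_nonneg fun _ _ => norm_nonneg _
  have hν0 : 0 ≤ ∑ i, |hE₁.eigenvalues i| := Finset.sum_nonneg fun _ _ => abs_nonneg _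
  have hK0 : 0 ≤ K := add_nonneg hG0 hν0
  have hC : 0 < (4 * K + 2 * K ^ 2) / g + 1 := by positivity
  have hCg : ((4 * K + 2 * K ^ 2) / g + 1) * g = 4 * K + 2 * K ^ 2 + g := by
    field_simp
  refine ⟨_, hC, fun ε hε l k hk => ?_⟩
  have hμ : |ithEig hE₁ l| ≤ K := by
    obtain ⟨i, hi⟩ := exists_ithEig_eq_eigenvalues hE₁ l
    rw [hi]
    have := Finset.single_le_sum (f := fun i => |hE₁.eigenvalues i|)
      (fun _ _ => abs_nonneg _) (Finset.mem_univ i)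
    linarith
  have hle := lt_card_filter_eigenvalues_le_ithEig hE₁ l
  have hge := card_le_card_filter_ithEig_le_eigenvalues_add hE₁ l
  have hr : Fintype.card (Fin r) = r := Fintype.card_fin r
  have hds := card_filter_lt_add_card_filter_gt hd
  refine abs_ithEig_sub_le_s16 (hAE ε) hP (hPMP ε) hG hg hC (by linarith) (by nlinarith)
    (by nlinarith) hμ hε hdg k ?_ ?_
  all_goals rcases hk with ⟨h0, hk⟩ | ⟨h0, hk⟩
  · have := Finset.card_le_card (Finset.monotone_filter_right Finset.univ
      fun i _ (h : hE₁.eigenvalues i ≤ ithEig hE₁ l) => mul_le_mul_of_nonneg_left h h0)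
    omega
  · have := Finset.card_le_card (Finset.monotone_filter_right Finset.univ
      fun i _ (h : ithEig hE₁ l ≤ hE₁.eigenvalues i) => mul_le_mul_of_nonpos_left h h0)
    omega
  · have := Finset.card_le_card (Finset.monotone_filter_right Finset.univ
      fun i _ (h : ithEig hE₁ l ≤ hE₁.eigenvalues i) => mul_le_mul_of_nonneg_left h h0)
    omega
  · have := Finset.card_le_card (Finset.monotone_filter_right Finset.univ
      fun i _ (h : hE₁.eigenvalues i ≤ ithEig hE₁ l) => mul_le_mul_of_nonpos_left h h0)
    omega

end Perturbation

/-- First-order expansion of a multiple eigenvalue with an `O(ε²)` (rather than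
`o(ε)`) trailing term: the `r` eigenvalues of `A + εE` emanating from the
multiple eigenvalue `λ₀` are `λ₀ + μ_i(Q₁ᴴEQ₁) ε + O(ε²)`. -/
theorem stmt_16 {r s : ℕ}
    (A E : Matrix (Fin r ⊕ Fin s) (Fin r ⊕ Fin s) ℂ)
    (hA : A.IsHermitian) (hE : E.IsHermitian)
    (hAE : ∀ ε : ℝ, (A + ε • E).IsHermitian)
    (lam0 : ℝ) (d : Fin s → ℝ) (hd : ∀ j, d j ≠ lam0)
    (Q : Matrix (Fin r ⊕ Fin s) (Fin r ⊕ Fin s) ℂ)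
    (hQ : Qᴴ * Q = 1)
    (hQAQ : Qᴴ * A * Q =
      fromBlocks ((lam0 : ℂ) • (1 : Matrix (Fin r) (Fin r) ℂ)) 0 0
        (Matrix.diagonal fun j => ((d j : ℝ) : ℂ)))
    (i₀ : ℕ)
    (hwin : ∀ i : Fin (Fintype.card (Fin r ⊕ Fin s)),
      ithEig hA i = lam0 ↔ i₀ ≤ (i : ℕ) ∧ (i : ℕ) < i₀ + r) :
    ∃ C > 0, ∀ ε : ℝ, |ε| ≤ 1 / C →
      ∃ σ : Fin r → Fin (Fintype.card (Fin r ⊕ Fin s)),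
        Function.Injective σ ∧ (∀ l, i₀ ≤ (σ l : ℕ) ∧ (σ l : ℕ) < i₀ + r) ∧
        ∀ l : Fin r,
          |ithEig (hAE ε) (σ l) -
            (lam0 + ithEig (Matrix.isHermitian_conjTranspose_mul_mul
              (Q.submatrix id Sum.inl) hE) ⟨l, by simp⟩ * ε)| ≤ C * ε ^ 2 := by
  obtain ⟨C, hC, hbound⟩ := exists_expansion_bound hAE hd hQ hQAQ
    (Matrix.isHermitian_conjTranspose_mul_mul (Q.submatrix id Sum.inl) hE)
  set m := (Finset.univ.filter fun j => d j < lam0).card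
  have hms : m ≤ s := by simpa using Finset.card_le_univ (Finset.univ.filter fun j => d j < lam0)
  have hcard : Fintype.card (Fin r ⊕ Fin s) = r + s := by simp
  have hA0 : ∀ k, ithEig (hAE 0) k = ithEig hA k := by
    have h : A + (0 : ℝ) • E = A := by simp
    intro k
    congr 1
  have hlt : ∀ l : Fin r, m + l < Fintype.card (Fin r ⊕ Fin s) := fun l => by omega
  have hwin₀ : ∀ l : Fin r, i₀ ≤ m + l ∧ m + l < i₀ + r := by
    intro l
    have h := hbound 0 (by simpa using hC.le) ⟨l, by simp⟩ ⟨m + l, hlt l⟩ (Or.inl ⟨le_rfl, rfl⟩)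
    rw [hA0] at h
    refine (hwin ⟨m + l, hlt l⟩).1 ?_
    simpa [sub_eq_zero] using h
  have him : 0 < r → i₀ = m := fun hr => by
    have h1 := hwin₀ ⟨0, hr⟩
    have h2 := hwin₀ ⟨r - 1, by omega⟩
    rw [Fin.val_mk] at h1 h2
    omega
  refine ⟨C, hC, fun ε hε => ?_⟩
  rcases le_total 0 ε with h0 | h0
  · refine ⟨fun l => ⟨m + l, hlt l⟩, fun l l' h => ?_, hwin₀, fun l => ?_⟩
    · simpa [Fin.ext_iff] using h
    · exact hbound ε hε ⟨l, by simp⟩ _ (Or.inl ⟨h0, rfl⟩)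
  · refine ⟨fun l => ⟨m + (r - 1 - l), by omega⟩, fun l l' h => ?_, fun l => ?_, fun l => ?_⟩
    · simp only [Fin.mk.injEq] at h
      omega
    · have := him l.pos
      rw [Fin.val_mk]
      omega
    · refine hbound ε hε ⟨l, by simp⟩ _ (Or.inr ⟨h0, ?_⟩)
      simp only
      omega
end
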